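/- arXiv:2303.04123 — 4 statements merged into one kernel-verified Lean document; each statement's English description precedes it below -/
import Mathlib

section
/- Consider cases 1 and 2 of the private FL scheme with within-segment permutations. Then the mutual information between the real sparse index sets and the permuted sparse index sets revealed to a database equals the joint entropy of the per-segment counts of sparse subpackets: I(X ; Y) = H(N_1, …, N_B). -/
open scoped BigOperators
open scoped Classical

noncomputable section

/-- Probability of an event on a finite probability space with weights `p`. -/
def pr {Ω : Type*} [Fintype Ω] (p : Ω → ℝ) (E : Ω → Prop) : ℝ :=
  ∑ ω, if E ω then p ω else 0

/-- Distribution (pmf) of a finitely valued random variable. -/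
def dist {Ω S : Type*} [Fintype Ω] (p : Ω → ℝ) (X : Ω → S) (s : S) : ℝ :=
  pr p (fun ω => X ω = s)

/-- Shannon entropy of a finitely valued random variable. -/
def entropy {Ω S : Type*} [Fintype Ω] (p : Ω → ℝ) (X : Ω → S) : ℝ :=
  ∑ s ∈ Finset.univ.image X, Real.negMulLog (dist p X s)

/-- Joint entropy of a pair of random variables. -/
def entropy2 {Ω S T : Type*} [Fintype Ω] (p : Ω → ℝ) (X : Ω → S) (Y : Ω → T) : ℝ :=
  entropy p (fun ω => (X ω, Y ω))

/-- Mutual information `I(X;Y) = H(X) + H(Y) - H(X,Y)`. -/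
def mutualInfo {Ω S T : Type*} [Fintype Ω] (p : Ω → ℝ) (X : Ω → S) (Y : Ω → T) : ℝ :=
  entropy p X + entropy p Y - entropy2 p X Y

/-- Conditional entropy `H(X|Y) = H(X,Y) - H(Y)`. -/
def condEntropy {Ω S T : Type*} [Fintype Ω] (p : Ω → ℝ) (X : Ω → S) (Y : Ω → T) : ℝ :=
  entropy2 p X Y - entropy p Y

/-- The probability of an event splits over the values of a finitely valued random variable. -/
lemma pr_eq_sum_pr_and {Ω S : Type*} [Fintype Ω] [Fintype S] (p : Ω → ℝ) (E : Ω → Prop)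
    (Z : Ω → S) : pr p E = ∑ z, pr p (fun ω => E ω ∧ Z ω = z) := by
  unfold pr
  rw [Finset.sum_comm]
  refine Finset.sum_congr rfl fun ω _ => ?_
  by_cases h : E ω <;> simp [h]

lemma dist_self_pos {Ω S : Type*} [Fintype Ω] {p : Ω → ℝ} (hp0 : ∀ ω, 0 ≤ p ω) (X : Ω → S)
    {ω : Ω} (hω : p ω ≠ 0) : 0 < dist p X (X ω) := by
  refine lt_of_lt_of_le ((hp0 ω).lt_of_ne' hω) ?_
  have := Finset.single_le_sum (f := fun ω' => if X ω' = X ω then p ω' else 0)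
    (fun ω' _ => by split_ifs <;> simp [hp0]) (Finset.mem_univ ω)
  simpa [_root_.dist, pr] using this

/-- Entropy is the expected surprisal. -/
lemma entropy_eq_sum_mul_neg_log {Ω S : Type*} [Fintype Ω] (p : Ω → ℝ) (X : Ω → S) :
    entropy p X = ∑ ω, p ω * -Real.log (dist p X (X ω)) := by
  unfold entropy
  rw [← Finset.sum_fiberwise_of_maps_to (s := Finset.univ) (t := Finset.univ.image X) (g := X)
    (fun ω _ => Finset.mem_image_of_mem X (Finset.mem_univ ω))]
  refine Finset.sum_congr rfl fun x _ => ?_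
  have h : ∀ ω ∈ Finset.univ.filter (fun ω => X ω = x),
      p ω * -Real.log (dist p X (X ω)) = p ω * -Real.log (dist p X x) := by
    intro ω hω
    rw [(Finset.mem_filter.1 hω).2]
  rw [Finset.sum_congr rfl h, ← Finset.sum_mul, Finset.sum_filter, Real.negMulLog]
  change -dist p X x * _ = dist p X x * _
  ring

lemma exists_perm_image_eq {α : Type*} [Fintype α] [DecidableEq α] {a b : Finset α}
    (h : a.card = b.card) :
    ∃ σ : Equiv.Perm α, a.image σ = b := by
  have e : {x // x ∈ a} ≃ {x // x ∈ b} := Finset.equivOfCardEq h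
  refine ⟨e.extendSubtype, Finset.eq_of_subset_of_card_le ?_ ?_⟩
  · intro y hy
    obtain ⟨x, hx, rfl⟩ := Finset.mem_image.1 hy
    exact e.extendSubtype_mem x hx
  · rw [Finset.card_image_of_injective _ (Equiv.injective _), h]

/-- The families of permutations whose inverses carry the sets `x i` to the sets `y i`. -/
def transporters {ι α : Type*} [Fintype ι] [Fintype α] [DecidableEq α] (x y : ι → Finset α) :
    Finset (ι → Equiv.Perm α) :=
  Finset.univ.filter fun g => ∀ i, (x i).image ⇑(g i)⁻¹ = y i

lemma card_transporters_congr {ι α : Type*} [Fintype ι] [Fintype α] [DecidableEq α]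
    {x x' : ι → Finset α} (y : ι → Finset α) (h : ∀ i, (x i).card = (x' i).card) :
    (transporters x y).card = (transporters x' y).card := by
  choose σ hσ using fun i => exists_perm_image_eq (h i)
  refine Finset.card_equiv (Equiv.mulLeft σ) fun g => ?_
  simp only [transporters, Finset.mem_filter, Finset.mem_univ, true_and, Equiv.coe_mulLeft,
    Pi.mul_apply]
  refine forall_congr' fun i => ?_
  rw [← hσ i, Finset.image_image, ← Equiv.Perm.coe_mul, mul_inv_rev, inv_mul_cancel_right]

lemma transporters_eq_empty {ι α : Type*} [Fintype ι] [Fintype α] [DecidableEq α] {x y : ι → Finset α}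
    (h : (fun i => (x i).card) ≠ fun i => (y i).card) : transporters x y = ∅ := by
  refine Finset.filter_eq_empty_iff.2 fun g _ hg => h (funext fun i => ?_)
  rw [← hg i, Finset.card_image_of_injective _ (Equiv.injective _)]

section UniformPermutations

variable {Ω ι α : Type*} [Fintype Ω] [Fintype ι] [Fintype α] [DecidableEq α] {p : Ω → ℝ}
  {X Y : Ω → ι → Finset α} {π : ι → Ω → Equiv.Perm α} {c : ℝ}

lemma dist_pair_eq_mul_card_transporters
    (hXπ : ∀ (x : ι → Finset α) (g : ι → Equiv.Perm α),
      pr p (fun ω => X ω = x ∧ ∀ i, π i ω = g i) = dist p X x * c)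
    (hY : ∀ ω i, Y ω i = (X ω i).image ⇑(π i ω)⁻¹) (x y : ι → Finset α) :
    dist p (fun ω => (X ω, Y ω)) (x, y) = dist p X x * (c * (transporters x y).card) := by
  have key : ∀ g : ι → Equiv.Perm α,
      pr p (fun ω => (X ω, Y ω) = (x, y) ∧ (fun i => π i ω) = g)
        = if g ∈ transporters x y then dist p X x * c else 0 := by
    intro g
    have hiff : ∀ ω, ((X ω, Y ω) = (x, y) ∧ (fun i => π i ω) = g) ↔
        (g ∈ transporters x y ∧ X ω = x ∧ ∀ i, π i ω = g i) := by
      intro ω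
      simp only [Prod.mk.injEq, transporters, Finset.mem_filter, Finset.mem_univ, true_and]
      constructor
      · rintro ⟨⟨rfl, rfl⟩, rfl⟩
        exact ⟨fun i => (hY ω i).symm, rfl, fun _ => rfl⟩
      · rintro ⟨hg, rfl, hπ⟩
        exact ⟨⟨rfl, funext fun i => by rw [hY, hπ i, hg i]⟩, funext hπ⟩
    simp only [hiff]
    split_ifs with hg
    · simpa only [hg, true_and] using hXπ x g
    · simp [pr, hg]
  rw [_root_.dist, pr_eq_sum_pr_and p _ fun ω i => π i ω, Finset.sum_congr rfl fun g _ => key g,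
    Finset.sum_ite_mem, Finset.univ_inter, Finset.sum_const, nsmul_eq_mul]
  ring

lemma dist_permuted_eq_mul_card_transporters
    (hXπ : ∀ (x : ι → Finset α) (g : ι → Equiv.Perm α),
      pr p (fun ω => X ω = x ∧ ∀ i, π i ω = g i) = dist p X x * c)
    (hY : ∀ ω i, Y ω i = (X ω i).image ⇑(π i ω)⁻¹) (y : ι → Finset α) :
    dist p Y y = dist p (fun ω i => (X ω i).card) (fun i => (y i).card)
      * (c * (transporters y y).card) := by
  rw [_root_.dist, _root_.dist, pr_eq_sum_pr_and p _ X, pr_eq_sum_pr_and p _ X, Finset.sum_mul]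
  refine Finset.sum_congr rfl fun x _ => ?_
  have hpair : pr p (fun ω => Y ω = y ∧ X ω = x) = dist p (fun ω => (X ω, Y ω)) (x, y) := by
    simp only [_root_.dist, Prod.mk.injEq, and_comm]
  rw [hpair, dist_pair_eq_mul_card_transporters hXπ hY]
  by_cases h : (fun i => (x i).card) = fun i => (y i).card
  · rw [card_transporters_congr y (congrFun h)]
    have hevent : (fun ω => X ω = x) =
        fun ω => (fun i => (X ω i).card) = (fun i => (y i).card) ∧ X ω = x :=
      funext fun ω => propext ⟨fun hx => ⟨by rw [hx]; exact h, hx⟩, And.right⟩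
    rw [_root_.dist, hevent]
  · have h0 : pr p (fun ω => (fun i => (X ω i).card) = (fun i => (y i).card) ∧ X ω = x) = 0 :=
      Finset.sum_eq_zero fun ω _ => if_neg fun hx => h (by rw [← hx.1, hx.2])
    rw [h0, transporters_eq_empty h]
    simp

end UniformPermutations

/-- With only within-segment permutations (cases 1 and 2), the
information leaked about the real sparse index sets `X` by the permuted index
sets `Y` equals the joint entropy of the per-segment counts:
`I(X ; Y) = H(|X_1|, …, |X_B|)`. -/
theorem information_leakage_within_segment
    {Ω : Type*} [Fintype Ω] (p : Ω → ℝ)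
    (hp0 : ∀ ω, 0 ≤ p ω) (hp1 : ∑ ω, p ω = 1)
    (B m s : ℕ) (hB : 0 < B) (hm : 0 < m) (hs : s ≤ B * m)
    (X : Ω → Fin B → Finset (Fin m))
    (hXs : ∀ ω, p ω ≠ 0 → ∑ i, (X ω i).card = s)
    (π : Fin B → Ω → Equiv.Perm (Fin m))
    (hπunif : ∀ i g, dist p (π i) g = (Fintype.card (Equiv.Perm (Fin m)) : ℝ)⁻¹)
    (hindep : ∀ (x : Fin B → Finset (Fin m)) (g : Fin B → Equiv.Perm (Fin m)),
      pr p (fun ω => X ω = x ∧ ∀ i, π i ω = g i)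
        = dist p X x * ∏ i, dist p (π i) (g i))
    (Y : Ω → Fin B → Finset (Fin m))
    (hY : ∀ ω i, Y ω i = (X ω i).image ⇑(π i ω)⁻¹) :
    mutualInfo p X Y = entropy p (fun ω => fun i => (X ω i).card) := by
  have hXπ : ∀ (x : Fin B → Finset (Fin m)) (g : Fin B → Equiv.Perm (Fin m)),
      pr p (fun ω => X ω = x ∧ ∀ i, π i ω = g i)
        = dist p X x * ∏ _i : Fin B, (Fintype.card (Equiv.Perm (Fin m)) : ℝ)⁻¹ := by
    intro x g
    simp only [hindep, hπunif]
  rw [mutualInfo, entropy2, entropy_eq_sum_mul_neg_log p X, entropy_eq_sum_mul_neg_log p Y,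
    entropy_eq_sum_mul_neg_log, entropy_eq_sum_mul_neg_log, ← Finset.sum_add_distrib,
    ← Finset.sum_sub_distrib]
  refine Finset.sum_congr rfl fun ω _ => ?_
  by_cases hω : p ω = 0
  · simp [hω]
  have hcard : ∀ i, (X ω i).card = (Y ω i).card := fun i => by
    rw [hY, Finset.card_image_of_injective _ (Equiv.injective _)]
  have hXY := dist_pair_eq_mul_card_transporters hXπ hY (X ω) (Y ω)
  have hYdist := dist_permuted_eq_mul_card_transporters hXπ hY (Y ω)
  rw [card_transporters_congr (Y ω) hcard] at hXY
  simp only [← hcard] at hYdist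
  have hX0 := (dist_self_pos hp0 X hω).ne'
  have hN0 := (dist_self_pos hp0 (fun ω i => (X ω i).card) hω).ne'
  have hk0 := right_ne_zero_of_mul (hYdist ▸ (dist_self_pos hp0 Y hω).ne')
  rw [hXY, hYdist, Real.log_mul hX0 hk0, Real.log_mul hN0 hk0]
  ring
end
end

section
/- Consider cases 3 and 4 of the private FL scheme with both within-segment and inter-segment permutations. Then the mutual information between the real sparse index sets and the permuted sparse index sets revealed to a database equals the entropy of the unordered multiset of per-segment counts: I(X ; Y) = H(M), where M is the multiset {N_1, …, N_B}. -/
open scoped BigOperators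
open scoped Classical

noncomputable section

lemma dist_eq_zero_of_notMem_image {Ω S : Type*} [Fintype Ω] (p : Ω → ℝ) (X : Ω → S) {s : S}
    (hs : s ∉ Finset.univ.image X) : dist p X s = 0 := by
  unfold _root_.dist pr
  refine Finset.sum_eq_zero fun ω _ => if_neg fun h => hs ?_
  exact Finset.mem_image.2 ⟨ω, Finset.mem_univ _, h⟩

lemma entropy_eq_sum_of_image_subset {Ω S : Type*} [Fintype Ω] (p : Ω → ℝ) (X : Ω → S)
    {t : Finset S} (ht : Finset.univ.image X ⊆ t) :
    entropy p X = ∑ s ∈ t, Real.negMulLog (dist p X s) :=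
  Finset.sum_subset ht fun s _ hs => by simp [dist_eq_zero_of_notMem_image p X hs]

lemma entropy_eq_sum_univ {Ω S : Type*} [Fintype Ω] [Fintype S] (p : Ω → ℝ) (X : Ω → S) :
    entropy p X = ∑ s, Real.negMulLog (dist p X s) :=
  entropy_eq_sum_of_image_subset p X (Finset.subset_univ _)

/-- The law of a function of a finitely valued random variable is a pushforward. -/
lemma dist_comp {Ω S T : Type*} [Fintype Ω] [Fintype S] (p : Ω → ℝ) (X : Ω → S) (f : S → T)
    (t : T) : dist p (fun ω => f (X ω)) t = ∑ s with f s = t, dist p X s := by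
  unfold _root_.dist pr
  rw [Finset.sum_comm]
  refine Finset.sum_congr rfl fun ω _ => ?_
  simp [Finset.sum_ite_eq]

/-- If, given `X = x`, the variable `Y` is uniform on the fibre of `f` through `x`, then
`I(X ; Y) = H(f(X))`. -/
theorem mutualInfo_eq_entropy_of_uniform_fiber {Ω S K : Type*} [Fintype Ω] [Fintype S]
    (p : Ω → ℝ) (X Y : Ω → S) (f : S → K)
    (hXY : ∀ x y, dist p (fun ω => (X ω, Y ω)) (x, y) =
      dist p X x * if f x = f y then ((Finset.univ.filter fun z => f z = f x).card : ℝ)⁻¹ else 0) :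
    mutualInfo p X Y = entropy p (fun ω => f (X ω)) := by
  set n : K → ℝ := fun k => ((Finset.univ.filter fun z => f z = k).card : ℝ) with hn
  have hn0 : ∀ x, n (f x) ≠ 0 := fun x =>
    Nat.cast_ne_zero.2 (Finset.card_ne_zero_of_mem (Finset.mem_filter.2 ⟨Finset.mem_univ x, rfl⟩))
  set L : K → ℝ := fun k => n k * Real.negMulLog (n k)⁻¹ with hL
  have hfib : ∀ k (c : ℝ), ∑ y, (if k = f y then c else 0) = n k * c := by
    intro k c
    simp only [hn, eq_comm (a := k)]
    rw [← Finset.sum_filter, Finset.sum_const, nsmul_eq_mul]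
  have hjoint : entropy2 p X Y = entropy p X + ∑ x, dist p X x * L (f x) := by
    rw [entropy2, entropy_eq_sum_univ, entropy_eq_sum_univ p X, Fintype.sum_prod_type,
      ← Finset.sum_add_distrib]
    refine Finset.sum_congr rfl fun x _ => ?_
    have : ∀ y, Real.negMulLog (dist p (fun ω => (X ω, Y ω)) (x, y)) =
        (if f x = f y then (n (f x))⁻¹ * Real.negMulLog (dist p X x)
          + dist p X x * Real.negMulLog (n (f x))⁻¹ else 0) := by
      intro y
      rw [hXY, Real.negMulLog_mul]
      split_ifs <;> simp [hn]
    simp only [this]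
    rw [hfib, hL]
    field_simp [hn0 x]
  have hYdist : ∀ y, dist p Y y = dist p (fun ω => f (X ω)) (f y) * (n (f y))⁻¹ := by
    intro y
    have h := dist_comp p (fun ω => (X ω, Y ω)) Prod.snd y
    simp only at h
    rw [h, dist_comp, Finset.sum_filter, Fintype.sum_prod_type, Finset.sum_filter, Finset.sum_mul]
    refine Finset.sum_congr rfl fun x _ => ?_
    rw [Finset.sum_eq_single y (by intro b _ hb; simp [hb]) (by simp)]
    simp only [if_true, hXY]
    split_ifs with hxy
    · rw [hxy]
    · simp
  have hYent : entropy p Y = entropy p (fun ω => f (X ω)) + ∑ x, dist p X x * L (f x) := by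
    have hsub : Finset.univ.image (fun ω => f (X ω)) ⊆ Finset.univ.image f := by
      intro k hk
      obtain ⟨ω, -, rfl⟩ := Finset.mem_image.1 hk
      exact Finset.mem_image_of_mem f (Finset.mem_univ _)
    have hmaps : ∀ x ∈ (Finset.univ : Finset S), f x ∈ Finset.univ.image f :=
      fun x hx => Finset.mem_image_of_mem f hx
    rw [entropy_eq_sum_univ, entropy_eq_sum_of_image_subset p _ hsub,
      ← Finset.sum_fiberwise_of_maps_to hmaps, ← Finset.sum_fiberwise_of_maps_to hmaps,
      ← Finset.sum_add_distrib]
    refine Finset.sum_congr rfl fun k hk => ?_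
    obtain ⟨x, -, rfl⟩ := Finset.mem_image.1 hk
    have h1 : ∀ y ∈ Finset.univ.filter (fun z => f z = f x),
        Real.negMulLog (dist p Y y) =
          Real.negMulLog (dist p (fun ω => f (X ω)) (f x) * (n (f x))⁻¹) := by
      intro y hy
      rw [hYdist, (Finset.mem_filter.1 hy).2]
    have h2 : ∀ y ∈ Finset.univ.filter (fun z => f z = f x),
        dist p X y * L (f y) = dist p X y * L (f x) := by
      intro y hy
      rw [(Finset.mem_filter.1 hy).2]
    rw [Finset.sum_congr rfl h1, Finset.sum_congr rfl h2, ← Finset.sum_mul, ← dist_comp,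
      Finset.sum_const, nsmul_eq_mul, Real.negMulLog_mul, hL]
    change n (f x) * _ = _
    field_simp [hn0 x]
  rw [mutualInfo, hjoint, hYent]
  ring

/-- Families with the same multiset of values differ by a permutation of the index set. -/
lemma exists_perm_of_map_univ_eq {ι κ : Type*} [Fintype ι] {a b : ι → κ}
    (h : Multiset.map a Finset.univ.val = Multiset.map b Finset.univ.val) :
    ∃ ρ : Equiv.Perm ι, ∀ i, b (ρ i) = a i := by
  have hcard : ∀ k, Nonempty ({i // a i = k} ≃ {i // b i = k}) := by
    intro k
    refine Fintype.card_eq.1 ?_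
    have := congrArg (Multiset.count k) h
    simp only [Multiset.count_map] at this
    simp only [Fintype.card_subtype, Finset.card_def, Finset.filter_val]
    simpa only [eq_comm] using this
  exact ⟨Equiv.ofFiberEquiv fun k => (hcard k).some, fun i => Equiv.ofFiberEquiv_map _ i⟩

/-- If the maps `w ↦ act x w` are, up to relabelling of `w`, transitive on the fibres of an
invariant `f`, then each of them is equidistributed on its fibre. -/
lemma card_filter_eq_of_transitive {S G K : Type*} [Fintype S] [Fintype G] (act : S → G → S)
    (f : S → K) (hinv : ∀ x w, f (act x w) = f x)
    (htrans : ∀ y y', f y = f y' → ∃ e : G → G, Function.Injective e ∧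
      ∀ x w, act x w = y → act x (e w) = y') (x y : S) (hxy : f x = f y) :
    (Finset.univ.filter fun z => f z = f x).card * (Finset.univ.filter fun w => act x w = y).card
      = Fintype.card G := by
  have hle : ∀ y y', f y = f y' → (Finset.univ.filter fun w => act x w = y).card ≤
      (Finset.univ.filter fun w => act x w = y').card := by
    intro y y' h
    obtain ⟨e, he, hact⟩ := htrans y y' h
    refine Finset.card_le_card_of_injOn e (fun w hw => ?_) he.injOn
    have hw' : act x w = y := by simpa using hw
    simpa using hact x w hw'
  have hconst : ∀ z ∈ Finset.univ.filter (fun z => f z = f x),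
      (Finset.univ.filter fun w => act x w = z).card =
        (Finset.univ.filter fun w => act x w = y).card := by
    intro z hz
    have hz' : f z = f y := (Finset.mem_filter.1 hz).2.trans hxy
    exact le_antisymm (hle z y hz') (hle y z hz'.symm)
  rw [← Finset.card_univ (α := G), Finset.card_eq_sum_card_fiberwise (s := Finset.univ) (f := act x)
    (t := Finset.univ.filter fun z => f z = f x) (by intro w _; simp [hinv]),
    Finset.sum_congr rfl hconst, Finset.sum_const, smul_eq_mul]

/-- If `W` is uniform given `X`, and `w ↦ act x w` is transitive on the fibres of an invariant `f`
in the sense of `card_filter_eq_of_transitive`, then `I(X ; act X W) = H(f(X))`. -/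
theorem mutualInfo_act_eq_entropy {Ω S G K : Type*} [Fintype Ω] [Fintype S] [Fintype G]
    [Nonempty G] (p : Ω → ℝ) (X : Ω → S) (W : Ω → G) (act : S → G → S) (f : S → K)
    (hinv : ∀ x w, f (act x w) = f x)
    (htrans : ∀ y y', f y = f y' → ∃ e : G → G, Function.Injective e ∧
      ∀ x w, act x w = y → act x (e w) = y')
    (hXW : ∀ x w, dist p (fun ω => (X ω, W ω)) (x, w) = dist p X x * (Fintype.card G : ℝ)⁻¹) :
    mutualInfo p X (fun ω => act (X ω) (W ω)) = entropy p (fun ω => f (X ω)) := by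
  refine mutualInfo_eq_entropy_of_uniform_fiber p X _ f fun x y => ?_
  have h := dist_comp p (fun ω => (X ω, W ω)) (fun q => (q.1, act q.1 q.2)) (x, y)
  simp only at h
  rw [h, Finset.sum_filter, Fintype.sum_prod_type,
    Finset.sum_eq_single x (by intro b _ hb; simp [hb]) (by simp)]
  simp only [Prod.mk.injEq, true_and, hXW]
  rw [← Finset.sum_filter, Finset.sum_const, nsmul_eq_mul]
  split_ifs with hxy
  · have hc := card_filter_eq_of_transitive act f hinv htrans x y hxy
    have hG : (Fintype.card G : ℝ) ≠ 0 := Nat.cast_ne_zero.2 Fintype.card_ne_zero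
    rw [← hc, Nat.cast_mul] at hG ⊢
    have h1 := left_ne_zero_of_mul hG
    have h2 := right_ne_zero_of_mul hG
    field_simp
  · rw [Finset.filter_eq_empty_iff.2]
    · simp
    · rintro w - rfl
      exact hxy (hinv x w).symm

/-- Permute each segment of `x` by `(w.1 i)⁻¹`, then reorder the segments by `w.2`. -/
def permuteSegments {ι α : Type*} (x : ι → Finset α) (w : (ι → Equiv.Perm α) × Equiv.Perm ι) :
    ι → Finset α :=
  fun j => (x (w.2 j)).image ⇑(w.1 (w.2 j))⁻¹

/-- The multiset of cardinalities of a family of finite sets. -/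
def cardMultiset {ι α : Type*} [Fintype ι] (x : ι → Finset α) : Multiset ℕ :=
  Multiset.map (fun i => (x i).card) Finset.univ.val

lemma cardMultiset_permuteSegments {ι α : Type*} [Fintype ι] (x : ι → Finset α)
    (w : (ι → Equiv.Perm α) × Equiv.Perm ι) :
    cardMultiset (permuteSegments x w) = cardMultiset x := by
  have hcard : ∀ j, (permuteSegments x w j).card = (x (w.2 j)).card := fun j =>
    Finset.card_image_of_injective _ (Equiv.injective _)
  simp only [cardMultiset, hcard]
  change Multiset.map ((fun i => (x i).card) ∘ w.2) _ = _
  rw [← Multiset.map_map]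
  congr 1
  simp

lemma permuteSegments_transitive {ι α : Type*} [Fintype ι] (y y' : ι → Finset α)
    (h : cardMultiset y = cardMultiset y') :
    ∃ e : (ι → Equiv.Perm α) × Equiv.Perm ι → (ι → Equiv.Perm α) × Equiv.Perm ι,
      Function.Injective e ∧
      ∀ x w, permuteSegments x w = y → permuteSegments x (e w) = y' := by
  obtain ⟨ρ, hρ⟩ := exists_perm_of_map_univ_eq h.symm
  choose g hg using fun j => Equiv.Perm.exists_map_finset_eq (y (ρ j)) (y' j) (hρ j)
  refine ⟨fun w => (fun i => w.1 i * (g (ρ⁻¹ (w.2⁻¹ i)))⁻¹, w.2 * ρ), ?_, ?_⟩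
  · rintro ⟨a, τ⟩ ⟨b, τ'⟩ hab
    obtain ⟨h1, h2⟩ := Prod.mk.injEq _ _ _ _ ▸ hab
    obtain rfl : τ = τ' := mul_right_cancel h2
    refine Prod.ext (funext fun i => ?_) rfl
    exact mul_right_cancel (congrFun h1 i)
  · rintro x w rfl
    funext j
    rw [← hg j, Finset.map_eq_image]
    simp only [permuteSegments, Finset.image_image]
    congr 1
    funext a
    simp

/-- With both within-segment and inter-segment permutations
(cases 3 and 4), the information leaked about the real sparse index sets `X`
by the permuted index sets `Y` equals the entropy of the unordered multiset of
per-segment counts: `I(X ; Y) = H({|X_1|, …, |X_B|})`. -/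
theorem information_leakage_two_stage
    {Ω : Type*} [Fintype Ω] (p : Ω → ℝ)
    (hp0 : ∀ ω, 0 ≤ p ω) (hp1 : ∑ ω, p ω = 1)
    (B m s : ℕ) (hB : 0 < B) (hm : 0 < m) (hs : s ≤ B * m)
    (X : Ω → Fin B → Finset (Fin m))
    (hXs : ∀ ω, p ω ≠ 0 → ∑ i, (X ω i).card = s)
    (π : Fin B → Ω → Equiv.Perm (Fin m))
    (σ : Ω → Equiv.Perm (Fin B))
    (hπunif : ∀ i g, dist p (π i) g = (Fintype.card (Equiv.Perm (Fin m)) : ℝ)⁻¹)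
    (hσunif : ∀ τ, dist p σ τ = (Fintype.card (Equiv.Perm (Fin B)) : ℝ)⁻¹)
    (hindep : ∀ (x : Fin B → Finset (Fin m)) (g : Fin B → Equiv.Perm (Fin m))
        (τ : Equiv.Perm (Fin B)),
      pr p (fun ω => X ω = x ∧ (∀ i, π i ω = g i) ∧ σ ω = τ)
        = dist p X x * (∏ i, dist p (π i) (g i)) * dist p σ τ)
    (Y : Ω → Fin B → Finset (Fin m))
    (hY : ∀ ω j, Y ω j = (X ω (σ ω j)).image ⇑(π (σ ω j) ω)⁻¹)
    (M : Ω → Multiset ℕ)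
    (hM : ∀ ω, M ω = Multiset.map (fun i => (X ω i).card) Finset.univ.val) :
    mutualInfo p X Y = entropy p M := by
  have hYact : Y = fun ω => permuteSegments (X ω) (fun i => π i ω, σ ω) := by
    funext ω j
    rw [hY, permuteSegments]
    congr
    exact Subsingleton.elim _ _
  have hMf : M = fun ω => cardMultiset (X ω) := funext hM
  rw [hYact, hMf]
  refine mutualInfo_act_eq_entropy p X (fun ω => (fun i => π i ω, σ ω)) permuteSegments
    cardMultiset cardMultiset_permuteSegments permuteSegments_transitive ?_
  rintro x ⟨g, τ⟩
  have h := hindep x g τ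
  simp only [hπunif, hσunif] at h
  have hev : dist p (fun ω => (X ω, ((fun i => π i ω), σ ω))) (x, (g, τ)) =
      pr p (fun ω => X ω = x ∧ (∀ i, π i ω = g i) ∧ σ ω = τ) := by
    simp only [_root_.dist, Prod.mk.injEq, funext_iff (f := fun i => π i _)]
  rw [hev, h, mul_assoc]
  congr 1
  simp [Fintype.card_prod, Fintype.card_pi, mul_comm]
end
end

section
/- (Decodability of the reading phase in cases 1 and 3: invertibility of the Cauchy–Vandermonde matrix.) Let F be a field, let ℓ ≥ 1 and N be natural numbers with N ≥ ℓ + 1, let f_1, …, f_ℓ ∈ F be distinct, and let α_1, …, α_N ∈ F be distinct with α_n ≠ f_j for all n and j. Then the N × N matrix M whose n-th row is (1/(f_1 − α_n), …, 1/(f_ℓ − α_n), 1, α_n, α_n², …, α_n^{N−ℓ−1}) is invertible. In particular, for N = 2ℓ + 2 (case 1) and N = 2ℓ + 4 (case 3), the users can recover the ℓ subpacket parameters from the N answers of the databases. -/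
open scoped BigOperators

open Polynomial in
/-- A combination of the simple fractions `1 / (f j - X)` and of the monomials `X ^ k`, `k < m`, that
vanishes at `ℓ + m` distinct points away from the poles is trivial. -/
theorem eq_zero_of_sum_inv_sub_add_sum_pow_eq_zero {F : Type*} [Field F] {ℓ m : ℕ}
    {f : Fin ℓ → F} (hf : Function.Injective f)
    {α : Fin (ℓ + m) → F} (hα : Function.Injective α) (hfα : ∀ n j, α n ≠ f j)
    {a : Fin ℓ → F} {b : Fin m → F}
    (h : ∀ n, ∑ j, (f j - α n)⁻¹ * a j + ∑ k : Fin m, α n ^ (k : ℕ) * b k = 0) :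
    a = 0 ∧ b = 0 := by
  set q : F[X] := ∑ k : Fin m, C (b k) * X ^ (k : ℕ) with hq
  set P : F[X] := q * Lagrange.nodal Finset.univ f
    - ∑ j, C (a j) * Lagrange.nodal (Finset.univ.erase j) f with hP
  have hq_deg : q.degree < m := by
    refine (degree_sum_le _ _).trans_lt ((Finset.sup_lt_iff (WithBot.bot_lt_coe m)).2 ?_)
    exact fun k _ => (degree_C_mul_X_pow_le _ _).trans_lt ((Nat.cast_lt.2 k.2))
  have hP_deg : P.degree < (Finset.univ : Finset (Fin (ℓ + m))).card := by
    rw [Finset.card_fin]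
    refine (degree_sub_le _ _).trans_lt (max_lt ?_ ?_)
    · rw [degree_mul, Lagrange.degree_nodal, Finset.card_fin, add_comm ℓ m, Nat.cast_add]
      exact WithBot.add_lt_add_right (WithBot.natCast_ne_bot ℓ) hq_deg
    · refine (degree_sum_le _ _).trans_lt
        ((Finset.sup_lt_iff (WithBot.bot_lt_coe (ℓ + m))).2 fun j _ => ?_)
      refine ((degree_mul_le _ _).trans (add_le_of_nonpos_left degree_C_le)).trans_lt ?_
      rw [Lagrange.degree_nodal, Finset.card_erase_of_mem (Finset.mem_univ j), Finset.card_fin]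
      have := j.2
      exact Nat.cast_lt.2 (show ℓ - 1 < ℓ + m by omega)
  have hP_eval (n : Fin (ℓ + m)) : P.eval (α n) = 0 := by
    have h_term (j : Fin ℓ) : a j * (Lagrange.nodal (Finset.univ.erase j) f).eval (α n)
        = -((f j - α n)⁻¹ * a j) * (Lagrange.nodal Finset.univ f).eval (α n) := by
      rw [Lagrange.nodal_eq_mul_nodal_erase (Finset.mem_univ j)]
      have := sub_ne_zero.2 (hfα n j).symm
      simp only [eval_mul, eval_sub, eval_X, eval_C]
      field_simp
      ring
    have h_q : q.eval (α n) = ∑ k : Fin m, α n ^ (k : ℕ) * b k := by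
      simp only [hq, eval_finsetSum, eval_mul, eval_C, eval_pow, eval_X, mul_comm]
    simp only [hP, eval_sub, eval_mul, eval_finsetSum, eval_C, h_term, h_q]
    rw [← Finset.sum_mul, ← sub_mul, Finset.sum_neg_distrib, sub_neg_eq_add, add_comm, h, zero_mul]
  have hP_zero : P = 0 :=
    eq_zero_of_degree_lt_of_eval_index_eq_zero _ hα.injOn hP_deg fun n _ => hP_eval n
  have ha : a = 0 := by
    funext j
    have h_eval : P.eval (f j) = 0 := by rw [hP_zero, eval_zero]
    simp only [hP, eval_sub, eval_mul, eval_finsetSum, eval_C] at h_eval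
    rw [Lagrange.eval_nodal_at_node (Finset.mem_univ j), mul_zero, zero_sub, neg_eq_zero,
      Finset.sum_eq_single j] at h_eval
    · refine (mul_eq_zero.1 h_eval).resolve_right (Lagrange.eval_nodal_not_at_node ?_)
      exact fun i hi => hf.ne (Finset.ne_of_mem_erase hi).symm
    · intro i _ hij
      rw [Lagrange.eval_nodal_at_node (Finset.mem_erase.2 ⟨hij.symm, Finset.mem_univ j⟩), mul_zero]
    · simp
  have hq_zero : q = 0 := by
    simpa [hP, ha, Lagrange.nodal_ne_zero] using hP_zero
  refine ⟨ha, funext fun k => ?_⟩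
  have h_coeff : q.coeff k = 0 := by rw [hq_zero, coeff_zero]
  simpa [hq, finsetSum_coeff, coeff_C_mul, coeff_X_pow, Fin.val_inj] using h_coeff

/-- Invertibility of the Cauchy–Vandermonde matrix arising in
the reading phase of cases 1 and 3: the `N × N` matrix whose `n`-th row is
`(1/(f_1 − α_n), …, 1/(f_ℓ − α_n), 1, α_n, α_n², …, α_n^{N−ℓ−1})` has nonzero
determinant whenever the `f_j` are distinct, the `α_n` are distinct, and
`α_n ≠ f_j` for all `n, j`. -/
theorem cauchy_vandermonde_invertible
    {F : Type*} [Field F] (ℓ N : ℕ) (hℓ : 1 ≤ ℓ) (hN : ℓ + 1 ≤ N)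
    (f : Fin ℓ → F) (hf : Function.Injective f)
    (α : Fin N → F) (hα : Function.Injective α)
    (hfα : ∀ (n : Fin N) (j : Fin ℓ), α n ≠ f j)
    (M : Matrix (Fin N) (Fin N) F)
    (hM : ∀ (n j : Fin N),
      M n j = if h : (j : ℕ) < ℓ then (f ⟨j, h⟩ - α n)⁻¹ else α n ^ ((j : ℕ) - ℓ)) :
    M.det ≠ 0 := by
  obtain ⟨m, rfl⟩ := Nat.exists_eq_add_of_le (Nat.le_of_succ_le hN)
  intro h_det
  obtain ⟨v, hv, hMv⟩ := Matrix.exists_mulVec_eq_zero_iff.2 h_det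
  obtain ⟨ha, hb⟩ := eq_zero_of_sum_inv_sub_add_sum_pow_eq_zero hf hα hfα
    (a := fun j => v (Fin.castAdd m j)) (b := fun k => v (Fin.natAdd ℓ k)) fun n => by
      simpa [Matrix.mulVec, dotProduct, Fin.sum_univ_add, hM] using congrFun hMv n
  exact hv (funext fun i => Fin.addCases (congrFun ha) (congrFun hb) i)
end

section
/- (Correctness of the writing phase: partial-fraction decomposition of the combined update.) Let F be a field, ℓ ≥ 1, and let f_1, …, f_ℓ ∈ F be distinct. Let Δ_1, …, Δ_ℓ ∈ F and Z ∈ F. Then for each i ∈ {1, …, ℓ} there exists a polynomial Q ∈ F[X] with deg Q ≤ ℓ − 1 (depending only on i, the f's, the Δ's and Z, but not on α) such that for every α ∈ F with α ∉ {f_1, …, f_ℓ}: (1/(f_i − α)) · ( ∑_{k=1}^ℓ (∏_{r≠k} (f_r − α)) · Δ_k / ∏_{r≠k} (f_r − f_k) + (∏_{r=1}^ℓ (f_r − α)) · Z ) = Δ_i/(f_i − α) + Q(α). Consequently, multiplying each noise-added combined update by the stored scaling 1/(f_i − α_n) correctly places the update Δ_i on the i-th parameter plus a polynomial noise term of degree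 at most ℓ − 1 in α_n. -/
open scoped BigOperators

open Polynomial in
/-- If `P` has degree at most `n`, then `P(α) / (a - α)` differs from `P(a) / (a - α)` by a
polynomial in `α` of degree at most `n - 1`. -/
theorem Polynomial.exists_inv_sub_mul_eval_eq {F : Type*} [Field F] (P : F[X]) {n : ℕ}
    (hP : P.natDegree ≤ n) (a : F) :
    ∃ Q : F[X], Q.degree ≤ (n - 1 : ℕ) ∧
      ∀ α : F, α ≠ a → (a - α)⁻¹ * P.eval α = P.eval a / (a - α) + Q.eval α := by
  refine ⟨-(P /ₘ (X - C a)), ?_, fun α hα => ?_⟩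
  · rw [degree_neg]
    refine degree_le_of_natDegree_le ?_
    rw [natDegree_divByMonic P (monic_X_sub_C a), natDegree_X_sub_C]
    exact Nat.sub_le_sub_right hP 1
  · have h := congrArg (eval α) (modByMonic_add_div P (X - C a))
    simp only [modByMonic_X_sub_C_eq_C_eval, eval_add, eval_mul, eval_sub, eval_X, eval_C] at h
    have hne : a - α ≠ 0 := sub_ne_zero.mpr hα.symm
    rw [← h, eval_neg]
    field_simp
    ring

open Polynomial in
/-- A product of linear factors `C (f r) - X` over `s` has degree at most the size of `s`. -/
theorem Polynomial.natDegree_prod_C_sub_X_le {ι R : Type*} [CommRing R] (s : Finset ι)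
    (f : ι → R) : (∏ r ∈ s, (C (f r) - X)).natDegree ≤ s.card := by
  refine (natDegree_prod_le s _).trans ?_
  refine (Finset.sum_le_card_nsmul s _ 1 fun r _ => ?_).trans (by simp)
  exact natDegree_sub_le_of_le (natDegree_C _).le natDegree_X_le |>.trans (by simp)

/-- Correctness of the writing phase (partial-fraction
decomposition of the combined update): for distinct `f_1, …, f_ℓ`, updates
`Δ_1, …, Δ_ℓ` and noise `Z`, for each `i` there is a polynomial `Q` of degree at
most `ℓ − 1` such that for every `α ∉ {f_1, …, f_ℓ}`,
`(f_i − α)⁻¹ ⬝ (∑_k (∏_{r≠k}(f_r − α)) ⬝ Δ_k / ∏_{r≠k}(f_r − f_k) + (∏_r (f_r − α)) ⬝ Z)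
  = Δ_i/(f_i − α) + Q(α)`. -/
theorem combined_update_partial_fractions
    {F : Type*} [Field F] (ℓ : ℕ) (hℓ : 1 ≤ ℓ)
    (f : Fin ℓ → F) (hf : Function.Injective f)
    (Δ : Fin ℓ → F) (Z : F) (i : Fin ℓ) :
    ∃ Q : Polynomial F, Q.degree ≤ (ℓ - 1 : ℕ) ∧
      ∀ α : F, (∀ r, α ≠ f r) →
        (f i - α)⁻¹ *
            ((∑ k, (∏ r ∈ Finset.univ.erase k, (f r - α))
                * (Δ k / ∏ r ∈ Finset.univ.erase k, (f r - f k)))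
              + (∏ r, (f r - α)) * Z)
          = Δ i / (f i - α) + Q.eval α := by
  let P : Polynomial F :=
    (∑ k, (∏ r ∈ Finset.univ.erase k, (Polynomial.C (f r) - Polynomial.X))
        * Polynomial.C (Δ k / ∏ r ∈ Finset.univ.erase k, (f r - f k)))
      + (∏ r, (Polynomial.C (f r) - Polynomial.X)) * Polynomial.C Z
  have eval_P (α : F) : P.eval α =
      (∑ k, (∏ r ∈ Finset.univ.erase k, (f r - α))
          * (Δ k / ∏ r ∈ Finset.univ.erase k, (f r - f k)))
        + (∏ r, (f r - α)) * Z := by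
    simp [P, Polynomial.eval_finsetSum, Polynomial.eval_prod]
  have natDegree_P : P.natDegree ≤ ℓ := by
    refine Polynomial.natDegree_add_le_of_degree_le ?_ ?_
    · refine Polynomial.natDegree_sum_le_of_forall_le _ _ fun k _ => ?_
      refine (Polynomial.natDegree_mul_C_le _ _).trans
        ((Polynomial.natDegree_prod_C_sub_X_le _ f).trans ?_)
      simp
    · refine (Polynomial.natDegree_mul_C_le _ _).trans
        ((Polynomial.natDegree_prod_C_sub_X_le _ f).trans ?_)
      simp
  have eval_P_node : P.eval (f i) = Δ i := by
    rw [eval_P, Finset.prod_eq_zero (Finset.mem_univ i) (sub_self (f i)), zero_mul, add_zero,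
      Finset.sum_eq_single_of_mem i (Finset.mem_univ i)]
    · refine mul_div_cancel₀ _ (Finset.prod_ne_zero_iff.mpr fun r hr => ?_)
      exact sub_ne_zero.mpr (hf.ne (Finset.ne_of_mem_erase hr))
    · intro k _ hk
      rw [Finset.prod_eq_zero (Finset.mem_erase.mpr ⟨hk.symm, Finset.mem_univ i⟩)
        (sub_self (f i)), zero_mul]
  obtain ⟨Q, hQ, h⟩ := P.exists_inv_sub_mul_eval_eq natDegree_P (f i)
  refine ⟨Q, hQ, fun α hα => ?_⟩
  rw [← eval_P, h α (hα i), eval_P_node]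
end
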